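/- Let S₁₀ be the symmetric group on {1,…,10}. For k = 1,…,5 let σ_k ∈ S₁₀ be the transposition exchanging 2k−1 and 2k, and let H be the subgroup generated by σ₁,…,σ₅. Let P be the collection of ten 2-element subsets {1,6}, {2,5}, {1,8}, {2,7}, {3,8}, {4,7}, {3,10}, {4,9}, {5,10}, {6,9}. Then the set of g ∈ H such that g maps every member of P to a member of P is exactly {identity, σ₁σ₂σ₃σ₄σ₅}; in particular this set is a subgroup of H isomorphic to ℤ/2ℤ. -/

import Mathlib

/-- The transposition `σ₁` exchanging the 1st and 2nd apex (labels `0` and `1` of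
`Fin 10`, standing for `1` and `2` of `{1, …, 10}`). -/
def sigma1 : Equiv.Perm (Fin 10) := Equiv.swap 0 1

/-- The transposition `σ₂` exchanging `3` and `4` (labels `2` and `3`). -/
def sigma2 : Equiv.Perm (Fin 10) := Equiv.swap 2 3

/-- The transposition `σ₃` exchanging `5` and `6` (labels `4` and `5`). -/
def sigma3 : Equiv.Perm (Fin 10) := Equiv.swap 4 5

/-- The transposition `σ₄` exchanging `7` and `8` (labels `6` and `7`). -/
def sigma4 : Equiv.Perm (Fin 10) := Equiv.swap 6 7

/-- The transposition `σ₅` exchanging `9` and `10` (labels `8` and `9`). -/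
def sigma5 : Equiv.Perm (Fin 10) := Equiv.swap 8 9

/-- The subgroup `H ≤ S₁₀` generated by `σ₁, …, σ₅`. -/
def Hsub : Subgroup (Equiv.Perm (Fin 10)) :=
  Subgroup.closure {sigma1, sigma2, sigma3, sigma4, sigma5}

/-- The ten pairs `{1,6}, {2,5}, {1,8}, {2,7}, {3,8}, {4,7}, {3,10}, {4,9}, {5,10},
{6,9}` of `{1, …, 10}`, written with `0`-based labels in `Fin 10`. -/
def Pairs : Set (Finset (Fin 10)) :=
  {{0, 5}, {1, 4}, {0, 7}, {1, 6}, {2, 7}, {3, 6}, {2, 9}, {3, 8}, {4, 9}, {5, 8}}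

/-- The elements of `Hsub` preserve the blocks `{2k, 2k+1}`. -/
lemma Hsub_block {g : Equiv.Perm (Fin 10)} (hg : g ∈ Hsub) :
    ∀ i : Fin 10, (g i).val / 2 = i.val / 2 := by
  unfold Hsub at hg
  induction hg using Subgroup.closure_induction with
  | mem x hx =>
    simp only [Set.mem_insert_iff, Set.mem_singleton_iff] at hx
    rcases hx with rfl | rfl | rfl | rfl | rfl <;> decide
  | one => intro i; rfl
  | mul x y _ _ hx hy =>
    intro i
    rw [Equiv.Perm.mul_apply, hx, hy]
  | inv x _ hx =>
    intro i
    have h := hx (x⁻¹ i)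
    rw [show x (x⁻¹ i) = i from Equiv.apply_symm_apply x i] at h
    exact h.symm

instance decidableMemPairs (p : Finset (Fin 10)) : Decidable (p ∈ Pairs) := by
  unfold Pairs
  simp only [Set.mem_insert_iff, Set.mem_singleton_iff]
  infer_instance

lemma tau_mem_Hsub : sigma1 * sigma2 * sigma3 * sigma4 * sigma5 ∈ Hsub := by
  unfold Hsub
  refine mul_mem (mul_mem (mul_mem (mul_mem ?_ ?_) ?_) ?_) ?_ <;>
    exact Subgroup.subset_closure (by simp)

/-- A pair of `Pairs` lying over the same two blocks as `{a, b}` agrees with `{a, b}` in both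
entries or in none. -/
lemma pair_step {a b x y : Fin 10} (hab : ({a, b} : Finset (Fin 10)) ∈ Pairs)
    (hx : x.val / 2 = a.val / 2) (hy : y.val / 2 = b.val / 2)
    (hxy : ({x, y} : Finset (Fin 10)) ∈ Pairs) (h : x = a) : y = b := by
  subst h
  clear hx
  revert x b y
  decide +kernel

lemma pair_fix {g : Equiv.Perm (Fin 10)} (hg : g ∈ Hsub)
    (hP : ∀ p ∈ Pairs, p.image g ∈ Pairs) (h0 : g 0 = 0) : g = 1 := by
  have hb := Hsub_block hg
  have step : ∀ a b : Fin 10, ({a, b} : Finset (Fin 10)) ∈ Pairs → g a = a → g b = b := by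
    intro a b hab h
    have h2 := hP _ hab
    rw [Finset.image_insert, Finset.image_singleton] at h2
    exact pair_step hab (hb a) (hb b) h2 h
  have h5 := step 0 5 (by decide) h0
  have h8 := step 5 8 (by decide) h5
  have h3 := step 8 3 (by decide) h8
  have h6 := step 3 6 (by decide) h3
  have h1 := step 6 1 (by decide) h6
  have h4 := step 1 4 (by decide) h1
  have h9 := step 4 9 (by decide) h4
  have h2 := step 9 2 (by decide) h9
  have h7 := step 2 7 (by decide) h2
  ext i
  fin_cases i <;> simp [*]

lemma tau_pairs : ∀ p ∈ Pairs,
    p.image (sigma1 * sigma2 * sigma3 * sigma4 * sigma5) ∈ Pairs := by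
  intro p hp
  have hp' := hp
  unfold Pairs at hp'
  simp only [Set.mem_insert_iff, Set.mem_singleton_iff] at hp'
  rcases hp' with rfl | rfl | rfl | rfl | rfl | rfl | rfl | rfl | rfl | rfl <;> decide

lemma tau_sq : (sigma1 * sigma2 * sigma3 * sigma4 * sigma5) *
    (sigma1 * sigma2 * sigma3 * sigma4 * sigma5) = 1 := by
  decide

lemma tau_ne_one : sigma1 * sigma2 * sigma3 * sigma4 * sigma5 ≠ 1 := by
  decide

/-- The elements of `H` mapping every member of `P` to a member of `P` are exactly
the identity and `σ₁σ₂σ₃σ₄σ₅`; in particular they form a subgroup of `H`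
isomorphic to `ℤ/2ℤ`. -/
theorem pair_preserving_subgroup :
    {g : Equiv.Perm (Fin 10) | g ∈ Hsub ∧ ∀ p ∈ Pairs, p.image g ∈ Pairs} =
      {1, sigma1 * sigma2 * sigma3 * sigma4 * sigma5} ∧
    ∃ K : Subgroup (Equiv.Perm (Fin 10)), K ≤ Hsub ∧
      (K : Set (Equiv.Perm (Fin 10))) =
        {1, sigma1 * sigma2 * sigma3 * sigma4 * sigma5} ∧
      Nonempty (K ≃* Multiplicative (ZMod 2)) := by
  constructor
  · ext g
    simp only [Set.mem_ofPred_eq, Set.mem_insert_iff, Set.mem_singleton_iff]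
    constructor
    · rintro ⟨hg, hP⟩
      have h0 : g 0 = 0 ∨ g 0 = 1 := by
        have h := Hsub_block hg 0
        generalize g 0 = x at h
        revert x
        decide
      rcases h0 with h0 | h0
      · exact Or.inl (pair_fix hg hP h0)
      · right
        have h1 : sigma1 * sigma2 * sigma3 * sigma4 * sigma5 * g = 1 := by
          refine pair_fix (mul_mem tau_mem_Hsub hg) ?_ ?_
          · intro p hp
            rw [Equiv.Perm.coe_mul, ← Finset.image_image]
            exact tau_pairs _ (hP p hp)
          · rw [Equiv.Perm.mul_apply, h0]
            decide
        exact mul_left_cancel (h1.trans tau_sq.symm)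
    · rintro (rfl | rfl)
      · exact ⟨one_mem _, fun p hp => by simpa using hp⟩
      · exact ⟨tau_mem_Hsub, tau_pairs⟩
  · have horder : orderOf (sigma1 * sigma2 * sigma3 * sigma4 * sigma5) = 2 :=
      orderOf_eq_prime (by rw [pow_two]; exact tau_sq) tau_ne_one
    refine ⟨Subgroup.zpowers (sigma1 * sigma2 * sigma3 * sigma4 * sigma5), ?_, ?_, ?_⟩
    · rw [Subgroup.zpowers_le]
      exact tau_mem_Hsub
    · ext g
      rw [SetLike.mem_coe, mem_zpowers_iff_mem_range_orderOf, horder]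
      simp [Finset.range_add_one, or_comm]
    · refine ⟨mulEquivOfCyclicCardEq ?_⟩
      rw [Nat.card_zpowers, horder]
      simp
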